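/- Let k, t, T be positive integers with T ≥ t+1 and k ≥ T. Then the optimal redundancy of function-correcting codes for the Hamming weight distribution function satisfies r_{Δ_T}(k,t) = 2t. -/

import Mathlib

/-- The optimal redundancy `r_f(k,t)`: the least `r` for which there exists a
function-correcting code `p : 𝔽₂^k → 𝔽₂^r` for `f` correcting `t` errors. -/
noncomputable def optRedundancy {α : Type*} (k t : ℕ) (f : (Fin k → ZMod 2) → α) : ℕ :=
  sInf {r : ℕ | ∃ p : (Fin k → ZMod 2) → (Fin r → ZMod 2),
    ∀ u v, f u ≠ f v → 2 * t + 1 ≤ hammingDist u v + hammingDist (p u) (p v)}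

lemma hermite_aux (n : ℕ) (hn : 0 < n) (a : ℕ) : ∑ i ∈ Finset.range n, (a + i) / n = a := by
  induction a with
  | zero =>
    apply Finset.sum_eq_zero
    intro i hi
    rw [Finset.mem_range] at hi
    rw [Nat.zero_add]
    exact Nat.div_eq_of_lt hi
  | succ a ih =>
    have h1 := Finset.sum_range_succ (fun i => (a + i) / n) n
    have h2 := Finset.sum_range_succ' (fun i => (a + i) / n) n
    have h3 : (a + n) / n = a / n + 1 := Nat.add_div_right a hn
    have h4 : ∀ i, a + 1 + i = a + (i + 1) := fun i => by ring
    simp only [h4]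
    simp only [Nat.add_zero] at h2
    omega

lemma hermite_fin (n : ℕ) (hn : 0 < n) (a : ℕ) : ∑ i : Fin n, (a + i.val) / n = a := by
  rw [Fin.sum_univ_eq_sum_range (fun i => (a + i) / n) n]
  exact hermite_aux n hn a

/-- The parity word attached to weight `w`. -/
def parityWord (n T w : ℕ) : Fin n → ZMod 2 :=
  fun i => (((w - w / T + i.val) / n + w / T : ℕ) : ZMod 2)

lemma hammingDist_eq_sum {n : ℕ} (x y : Fin n → ZMod 2) :
    hammingDist x y = ∑ i, if x i ≠ y i then 1 else 0 := by
  rw [hammingDist, Finset.card_filter]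

lemma floor_step (n a b i : ℕ) (hn : 0 < n) (h1 : a ≤ b) (h2 : b ≤ a + n) :
    (b + i) / n = (a + i) / n ∨ (b + i) / n = (a + i) / n + 1 := by
  have h3 : (a + i) / n ≤ (b + i) / n := Nat.div_le_div_right (by omega)
  have h4 : (b + i) / n ≤ (a + i + n) / n := Nat.div_le_div_right (by omega)
  rw [Nat.add_div_right _ hn] at h4
  omega

lemma parity_dist (t T x y : ℕ) (ht : 0 < t) (hT : t + 1 ≤ T) (hxy : x ≤ y)
    (hq : x / T ≠ y / T) :
    2 * t + 1 ≤ (y - x) + hammingDist (parityWord (2 * t) T x) (parityWord (2 * t) T y) := by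
  by_cases hd : 2 * t + 1 ≤ y - x
  · omega
  have hT0 : 0 < T := by omega
  have hle : x / T ≤ y / T := Nat.div_le_div_right hxy
  have ex := Nat.div_add_mod x T
  have ey := Nat.div_add_mod y T
  have mx := Nat.mod_lt x hT0
  have my := Nat.mod_lt y hT0
  have lx := Nat.div_le_self x T
  have ly := Nat.div_le_self y T
  obtain ⟨a, ha⟩ : ∃ a, a = x - x / T := ⟨_, rfl⟩
  obtain ⟨b, hb⟩ : ∃ b, b = y - y / T := ⟨_, rfl⟩
  have hn : 0 < 2 * t := by omega
  have Sa := hermite_fin (2 * t) hn a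
  have Sb := hermite_fin (2 * t) hn b
  rw [hammingDist_eq_sum]
  simp only [parityWord, ← ha, ← hb, ne_eq, ZMod.natCast_eq_natCast_iff']
  generalize x / T = p at *
  generalize y / T = q at *
  obtain ⟨c, rfl⟩ : ∃ c, q = p + 1 + c := ⟨q - p - 1, by omega⟩
  have hc : c < 2 := by
    by_contra hc
    have : T * 2 ≤ T * c := Nat.mul_le_mul_left T (by omega)
    have e : T * (p + 1 + c) = T * p + T + T * c := by ring
    omega
  interval_cases c
  · have e : T * (p + 1 + 0) = T * p + T := by ring
    have hab : a ≤ b := by omega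
    have hba : b ≤ a + 2 * t := by omega
    have key : ∑ i : Fin (2 * t), ((if ¬ ((a + i.val) / (2 * t) + p) % 2 =
        ((b + i.val) / (2 * t) + (p + 1 + 0)) % 2 then 1 else 0) + (b + i.val) / (2 * t))
        = ∑ i : Fin (2 * t), (1 + (a + i.val) / (2 * t)) := by
      apply Finset.sum_congr rfl
      intro i _
      rcases floor_step (2 * t) a b i.val hn hab hba with h | h <;> rw [h] <;> split_ifs <;> omega
    rw [Finset.sum_add_distrib, Finset.sum_add_distrib, Sa, Sb] at key
    simp only [Finset.sum_const, Finset.card_univ, Fintype.card_fin, smul_eq_mul, mul_one] at key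
    omega
  · have e : T * (p + 1 + 1) = T * p + T + T := by ring
    have hab : a ≤ b := by omega
    have hba : b ≤ a + 2 * t := by omega
    have key : ∑ i : Fin (2 * t), ((if ¬ ((a + i.val) / (2 * t) + p) % 2 =
        ((b + i.val) / (2 * t) + (p + 1 + 1)) % 2 then 1 else 0) + (a + i.val) / (2 * t))
        = ∑ i : Fin (2 * t), (b + i.val) / (2 * t) := by
      apply Finset.sum_congr rfl
      intro i _
      rcases floor_step (2 * t) a b i.val hn hab hba with h | h <;> rw [h] <;> split_ifs <;> omega
    rw [Finset.sum_add_distrib, Sa, Sb] at key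
    omega

lemma norm_le_add_dist {k : ℕ} (u v : Fin k → ZMod 2) :
    hammingNorm v ≤ hammingNorm u + hammingDist u v := by
  have h := hammingDist_triangle v u 0
  rw [hammingDist_zero_right, hammingDist_zero_right, hammingDist_comm v u] at h
  omega

/-- The vector with ones exactly in the first `m` coordinates. -/
def stepVec (k m : ℕ) : Fin k → ZMod 2 := fun i => if i.val < m then 1 else 0

lemma norm_stepVec (k m : ℕ) (h : m ≤ k) : hammingNorm (stepVec k m) = m := by
  have : hammingNorm (stepVec k m) = ∑ i : Fin k, if i.val < m then 1 else 0 := by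
    rw [hammingNorm, Finset.card_filter]
    apply Finset.sum_congr rfl
    intro i _
    by_cases hi : i.val < m <;> simp [stepVec, hi]
  rw [this, ← Finset.card_filter, Fin.card_filter_val_lt]
  omega

lemma dist_stepVec (k m : ℕ) (h : m + 1 ≤ k) :
    hammingDist (stepVec k m) (stepVec k (m + 1)) ≤ 1 := by
  refine le_trans (Finset.card_le_card (t := {(⟨m, h⟩ : Fin k)}) ?_) (Finset.card_singleton _).le
  intro i hi
  rw [Finset.mem_filter] at hi
  rw [Finset.mem_singleton]
  by_contra hne
  apply hi.2
  have hne' : i.val ≠ m := fun h => hne (Fin.ext h)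
  have : i.val < m ↔ i.val < m + 1 := by omega
  simp only [stepVec, this]

theorem stmt_14 (k t T : ℕ) (hk : 0 < k) (ht : 0 < t) (hT : t + 1 ≤ T) (hkT : T ≤ k) :
    optRedundancy k t (fun u => hammingNorm u / T) = 2 * t := by
  have hmem : ∃ p : (Fin k → ZMod 2) → (Fin (2 * t) → ZMod 2),
      ∀ u v, hammingNorm u / T ≠ hammingNorm v / T →
        2 * t + 1 ≤ hammingDist u v + hammingDist (p u) (p v) := by
    refine ⟨fun u => parityWord (2 * t) T (hammingNorm u), ?_⟩
    intro u v huv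
    have h1 := norm_le_add_dist u v
    have h2 := norm_le_add_dist v u
    rw [hammingDist_comm v u] at h2
    rcases le_total (hammingNorm u) (hammingNorm v) with h | h
    · have := parity_dist t T _ _ ht hT h huv
      dsimp only
      omega
    · have := parity_dist t T _ _ ht hT h huv.symm
      rw [hammingDist_comm] at this
      dsimp only
      omega
  apply le_antisymm
  · exact Nat.sInf_le hmem
  · unfold optRedundancy
    refine le_csInf (Set.nonempty_of_mem (x := 2 * t) ?_) ?_
    · exact hmem
    rintro r ⟨p, hp⟩
    obtain ⟨m, rfl⟩ : ∃ m, T = m + 1 := ⟨T - 1, by omega⟩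
    have h := hp (stepVec k m) (stepVec k (m + 1)) (by
      dsimp only
      rw [norm_stepVec k m (by omega), norm_stepVec k (m + 1) hkT,
        Nat.div_eq_of_lt (Nat.lt_succ_self m), Nat.div_self (Nat.succ_pos m)]
      exact zero_ne_one)
    have h1 := dist_stepVec k m hkT
    have h2 : hammingDist (p (stepVec k m)) (p (stepVec k (m + 1))) ≤ r := by
      simpa using hammingDist_le_card_fintype (x := p (stepVec k m)) (y := p (stepVec k (m + 1)))
    omega
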